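/- Divergence rate of the coefficient statistic during the bubble (displayed rate in the proof of Theorem 3). Under the bubble model with Assumptions A1 and A2 and the initial-value condition, for every fixed r with r_e < r ≤ r_f, the normalized coefficient statistic n^{α−1} · SV-ADF^δ_{⌊nr⌋} = n^{α−1} · ⌊nr⌋·(δ̂(⌊nr⌋) − 1) converges in probability to r·c as n → ∞; in particular SV-ADF^δ_{⌊nr⌋} diverges to +∞ at rate n^{1−α}. -/

import Mathlib

open MeasureTheory ProbabilityTheory Filter

/-- The average innovation variance `m_{n,k} = k⁻¹ Σ_{t=1}^k E[σ_t²]`. -/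
noncomputable def avgVar {Ω : Type*} [MeasurableSpace Ω] (P : ℕ → Measure Ω)
    (σ : ℕ → ℕ → Ω → ℝ) (n k : ℕ) : ℝ :=
  (∑ t ∈ Finset.Icc 1 k, ∫ ω, (σ n t ω) ^ 2 ∂(P n)) / k

/-- Recursive sample mean `X̄_τ = τ⁻¹ Σ_{k=1}^τ X_{k-1}`. -/
noncomputable def xbar {Ω : Type*} (X : ℕ → Ω → ℝ) (τ : ℕ) (ω : Ω) : ℝ :=
  (∑ k ∈ Finset.Icc 1 τ, X (k - 1) ω) / τ

/-- Demeaned observation `X̃_j = X_j - X̄_τ`. -/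
noncomputable def xtil {Ω : Type*} (X : ℕ → Ω → ℝ) (τ j : ℕ) (ω : Ω) : ℝ :=
  X j ω - xbar X τ ω

/-- OLS slope `δ̂(τ) = (Σ_{j=1}^τ X̃_{j-1} X_j)/(Σ_{j=1}^τ X̃_{j-1}²)`. -/
noncomputable def deltaHat {Ω : Type*} (X : ℕ → Ω → ℝ) (τ : ℕ) (ω : Ω) : ℝ :=
  (∑ j ∈ Finset.Icc 1 τ, xtil X τ (j - 1) ω * X j ω) /
    ∑ j ∈ Finset.Icc 1 τ, (xtil X τ (j - 1) ω) ^ 2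

/-- Coefficient-based recursive statistic `SV-ADF^δ_τ = τ (δ̂(τ) - 1)`. -/
noncomputable def svadfDelta {Ω : Type*} (X : ℕ → Ω → ℝ) (τ : ℕ) (ω : Ω) : ℝ :=
  (τ : ℝ) * (deltaHat X τ ω - 1)



/-- Heat-kernel test function. -/
noncomputable def heatF (h x v : ℝ) : ℝ :=
  if 0 ≤ v then Real.sqrt (h / (h + v)) * Real.exp (-x ^ 2 / (2 * (h + v))) else 0

lemma heatF_nonneg (h x v : ℝ) : 0 ≤ heatF h x v := by
  unfold heatF; split_ifs <;> positivity

lemma heatF_measurable (h : ℝ) : Measurable (fun p : ℝ × ℝ => heatF h p.1 p.2) := by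
  unfold heatF
  refine Measurable.ite (measurableSet_le measurable_const measurable_snd) ?_ measurable_const
  fun_prop

lemma heat_integral (h q y a : ℝ) (hh : 0 < h) (hq : 0 < q) :
    ∫ x, Real.sqrt (h / q) * Real.exp (-(y + a * x) ^ 2 / (2 * q)) ∂(gaussianReal 0 1)
      = Real.sqrt (h / (q + a ^ 2)) * Real.exp (-y ^ 2 / (2 * (q + a ^ 2))) := by
  have hs : 0 < q + a ^ 2 := by positivity
  rw [integral_gaussianReal_eq_integral_smul (by norm_num)]
  have key : ∀ x : ℝ, gaussianPDFReal 0 1 x • (Real.sqrt (h / q) * Real.exp (-(y + a * x) ^ 2 / (2 * q)))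
      = ((Real.sqrt (2 * Real.pi))⁻¹ * Real.sqrt (h / q) * Real.exp (-y ^ 2 / (2 * (q + a ^ 2)))) *
        Real.exp (-((q + a ^ 2) / (2 * q)) * (x - (-(y * a) / (q + a ^ 2))) ^ 2) := by
    intro x
    simp only [gaussianPDFReal, smul_eq_mul, NNReal.coe_one, mul_one, sub_zero]
    have : Real.exp (-x ^ 2 / 2) * Real.exp (-(y + a * x) ^ 2 / (2 * q)) =
        Real.exp (-y ^ 2 / (2 * (q + a ^ 2))) *
        Real.exp (-((q + a ^ 2) / (2 * q)) * (x - (-(y * a) / (q + a ^ 2))) ^ 2) := by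
      rw [← Real.exp_add, ← Real.exp_add]
      congr 1
      field_simp
      ring
    linear_combination ((Real.sqrt (2 * Real.pi))⁻¹ * Real.sqrt (h / q)) * this
  simp_rw [key]
  rw [integral_const_mul,
    integral_sub_right_eq_self (fun x => Real.exp (-((q + a ^ 2) / (2 * q)) * x ^ 2)), integral_gaussian]
  have : (Real.sqrt (2 * Real.pi))⁻¹ * Real.sqrt (h / q) * Real.sqrt (Real.pi / ((q + a ^ 2) / (2 * q)))
      = Real.sqrt (h / (q + a ^ 2)) := by
    rw [← Real.sqrt_inv, ← Real.sqrt_mul (by positivity), ← Real.sqrt_mul (by positivity)]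
    congr 1
    have := Real.pi_pos
    field_simp
  rw [← this]; ring

lemma heat_step (h y v a : ℝ) (hh : 0 < h) :
    ∫⁻ e, ENNReal.ofReal (heatF h (y + a * e) (v - a ^ 2)) ∂(gaussianReal 0 1)
      ≤ ENNReal.ofReal (heatF h y v) := by
  by_cases hv : 0 ≤ v - a ^ 2
  · have hv' : 0 ≤ v := by nlinarith [sq_nonneg a]
    simp only [heatF, hv, hv', if_true]
    have hq : 0 < h + (v - a ^ 2) := by positivity
    rw [← ofReal_integral_eq_lintegral_ofReal]
    · rw [heat_integral h _ y a hh hq]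
      have : h + (v - a ^ 2) + a ^ 2 = h + v := by ring
      rw [this]
    · refine Integrable.const_mul ?_ _
      refine Integrable.of_bound (C := 1) (by fun_prop) (Eventually.of_forall fun x => ?_)
      rw [Real.norm_of_nonneg (Real.exp_nonneg _), Real.exp_le_one_iff]
      rw [neg_div]
      have : 0 ≤ (y + a * x) ^ 2 / (2 * (h + (v - a ^ 2))) := by positivity
      linarith
    · exact Eventually.of_forall fun x => by positivity
  · simp [heatF, hv]

/-- One-step supermartingale inequality. -/
lemma heat_indep {Ω : Type*} (m : MeasurableSpace Ω) [MeasurableSpace Ω] (P : Measure Ω)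
    [IsProbabilityMeasure P] (hm : m ≤ ‹MeasurableSpace Ω›) (h : ℝ) (hh : 0 < h)
    (y v a e : Ω → ℝ) (hy : Measurable[m] y) (hv : Measurable[m] v) (ha : Measurable[m] a)
    (he : Measurable e) (hg : Measure.map e P = gaussianReal 0 1)
    (hi : Indep (MeasurableSpace.comap e inferInstance) m P) :
    ∫⁻ ω, ENNReal.ofReal (heatF h (y ω + a ω * e ω) (v ω - a ω ^ 2)) ∂P
      ≤ ∫⁻ ω, ENNReal.ofReal (heatF h (y ω) (v ω)) ∂P := by
  have hA : Measurable[m] (fun ω => (y ω, v ω, a ω)) := hy.prodMk (hv.prodMk ha)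
  have hA' : Measurable (fun ω => (y ω, v ω, a ω)) := hA.mono hm le_rfl
  have hind : IndepFun (fun ω => (y ω, v ω, a ω)) e P := by
    have := indep_of_indep_of_le_right hi hA.comap_le
    exact (IndepFun_iff_Indep _ _ _).2 this.symm
  have hmap := (indepFun_iff_map_prod_eq_prod_map_map hA'.aemeasurable he.aemeasurable).1 hind
  have hG : Measurable (fun p : (ℝ × ℝ × ℝ) × ℝ =>
      ENNReal.ofReal (heatF h (p.1.1 + p.1.2.2 * p.2) (p.1.2.1 - p.1.2.2 ^ 2))) := by
    refine ENNReal.measurable_ofReal.comp ?_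
    exact (heatF_measurable h).comp (f := fun p : (ℝ × ℝ × ℝ) × ℝ =>
      (p.1.1 + p.1.2.2 * p.2, p.1.2.1 - p.1.2.2 ^ 2)) (by fun_prop)
  have h1 : ∫⁻ ω, ENNReal.ofReal (heatF h (y ω + a ω * e ω) (v ω - a ω ^ 2)) ∂P
      = ∫⁻ p, ENNReal.ofReal (heatF h (p.1.1 + p.1.2.2 * p.2) (p.1.2.1 - p.1.2.2 ^ 2))
        ∂(P.map (fun ω => ((y ω, v ω, a ω), e ω))) := by
    rw [lintegral_map hG (hA'.prodMk he)]
  rw [h1, hmap, lintegral_prod _ hG.aemeasurable, hg]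
  have h2 : ∫⁻ ω, ENNReal.ofReal (heatF h (y ω) (v ω)) ∂P
      = ∫⁻ p : ℝ × ℝ × ℝ, ENNReal.ofReal (heatF h p.1 p.2.1) ∂(P.map (fun ω => (y ω, v ω, a ω))) := by
    rw [lintegral_map _ hA']
    exact ENNReal.measurable_ofReal.comp
      ((heatF_measurable h).comp (f := fun p : ℝ × ℝ × ℝ => (p.1, p.2.1)) (by fun_prop))
  rw [h2]
  exact lintegral_mono fun p => heat_step h p.1 p.2.1 p.2.2 hh

lemma heat_iter {Ω : Type*} [MeasurableSpace Ω] (P : Measure Ω) [IsProbabilityMeasure P]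
    (F : ℕ → MeasurableSpace Ω) (hmono : Monotone F) (hle : ∀ t, F t ≤ ‹MeasurableSpace Ω›)
    (X0 : Ω → ℝ) (σ ε : ℕ → Ω → ℝ) (n : ℕ) (hX0 : Measurable[F 0] X0)
    (hσ : ∀ t, 1 ≤ t → t ≤ n → Measurable[F (t - 1)] (σ t))
    (hε : ∀ t, Measurable (ε t))
    (hg : ∀ t, 1 ≤ t → t ≤ n → Measure.map (ε t) P = gaussianReal 0 1)
    (hi : ∀ t, 1 ≤ t → t ≤ n → Indep (MeasurableSpace.comap (ε t) inferInstance) (F (t - 1)) P)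
    (hu : ∀ t, 1 ≤ t → t ≤ n → Measurable[F t] (fun ω => σ t ω * ε t ω))
    (w : ℕ → ℝ) (h vb : ℝ) (hh : 0 < h) (hvb : 0 ≤ vb) (k : ℕ) (hk : k ≤ n) :
    ∫⁻ ω, ENNReal.ofReal (heatF h (X0 ω + ∑ t ∈ Finset.Icc 1 k, w t * (σ t ω * ε t ω))
      (vb - ∑ t ∈ Finset.Icc 1 k, w t ^ 2 * σ t ω ^ 2)) ∂P
      ≤ ENNReal.ofReal (Real.sqrt (h / (h + vb))) := by
  induction k with
  | zero =>
    calc _ ≤ ∫⁻ ω, ENNReal.ofReal (Real.sqrt (h / (h + vb))) ∂P := by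
          refine lintegral_mono fun ω => ENNReal.ofReal_le_ofReal ?_
          simp only [heatF, Finset.Icc_eq_empty_of_lt Nat.zero_lt_one, Finset.sum_empty,
            sub_zero, hvb, if_true]
          refine mul_le_of_le_one_right (by positivity) ?_
          rw [Real.exp_le_one_iff, neg_div]
          have : 0 ≤ (X0 ω + 0) ^ 2 / (2 * (h + vb)) := by positivity
          linarith
      _ = _ := by simp
  | succ k ih =>
    refine le_trans ?_ (ih (by omega))
    have key := heat_indep (F k) P (hle k) h hh
      (fun ω => X0 ω + ∑ t ∈ Finset.Icc 1 k, w t * (σ t ω * ε t ω))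
      (fun ω => vb - ∑ t ∈ Finset.Icc 1 k, w t ^ 2 * σ t ω ^ 2)
      (fun ω => w (k + 1) * σ (k + 1) ω) (ε (k + 1)) ?_ ?_ ?_ (hε _)
      (hg _ (by omega) hk) (hi _ (by omega) hk)
    · refine le_trans (le_of_eq ?_) key
      refine lintegral_congr fun ω => ?_
      rw [Finset.sum_Icc_succ_top (by omega), Finset.sum_Icc_succ_top (by omega)]
      congr 2 <;> ring
    · refine Measurable.add (hX0.mono (hmono (by omega)) le_rfl) ?_
      refine Finset.measurable_sum _ fun t ht => ?_
      rw [Finset.mem_Icc] at ht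
      exact ((hu t ht.1 (by omega)).mono (hmono ht.2) le_rfl).const_mul _
    · refine Measurable.sub measurable_const ?_
      refine Finset.measurable_sum _ fun t ht => ?_
      rw [Finset.mem_Icc] at ht
      exact (((hσ t ht.1 (by omega)).mono (hmono (by omega)) le_rfl).pow_const 2).const_mul _
    · exact (hσ (k + 1) (by omega) hk).const_mul _

/-- Anti-concentration of weighted Gaussian martingale sums. -/
lemma anticonc {Ω : Type*} [MeasurableSpace Ω] (P : Measure Ω) [IsProbabilityMeasure P]
    (F : ℕ → MeasurableSpace Ω) (hmono : Monotone F) (hle : ∀ t, F t ≤ ‹MeasurableSpace Ω›)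
    (X0 : Ω → ℝ) (σ ε : ℕ → Ω → ℝ) (n : ℕ) (hX0 : Measurable[F 0] X0)
    (hσ : ∀ t, 1 ≤ t → t ≤ n → Measurable[F (t - 1)] (σ t))
    (hε : ∀ t, Measurable (ε t))
    (hg : ∀ t, 1 ≤ t → t ≤ n → Measure.map (ε t) P = gaussianReal 0 1)
    (hi : ∀ t, 1 ≤ t → t ≤ n → Indep (MeasurableSpace.comap (ε t) inferInstance) (F (t - 1)) P)
    (hu : ∀ t, 1 ≤ t → t ≤ n → Measurable[F t] (fun ω => σ t ω * ε t ω))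
    (w : ℕ → ℝ) (h vb : ℝ) (hh : 0 < h) (hvb : 0 ≤ vb) (k : ℕ) (hk : k ≤ n) :
    P {ω | (X0 ω + ∑ t ∈ Finset.Icc 1 k, w t * (σ t ω * ε t ω)) ^ 2 ≤ h ∧
        ∑ t ∈ Finset.Icc 1 k, w t ^ 2 * σ t ω ^ 2 ≤ vb ∧
        vb - h ≤ ∑ t ∈ Finset.Icc 1 k, w t ^ 2 * σ t ω ^ 2} ≤
      ENNReal.ofReal (4 * Real.sqrt (h / (h + vb))) := by
  have it := heat_iter P F hmono hle X0 σ ε n hX0 hσ hε hg hi hu w h vb hh hvb k hk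
  have hmeas : Measurable (fun ω => ENNReal.ofReal (heatF h (X0 ω + ∑ t ∈ Finset.Icc 1 k, w t * (σ t ω * ε t ω))
      (vb - ∑ t ∈ Finset.Icc 1 k, w t ^ 2 * σ t ω ^ 2))) := by
    refine ENNReal.measurable_ofReal.comp ?_
    refine (heatF_measurable h).comp (f := fun ω => (X0 ω + ∑ t ∈ Finset.Icc 1 k, w t * (σ t ω * ε t ω),
      vb - ∑ t ∈ Finset.Icc 1 k, w t ^ 2 * σ t ω ^ 2)) (Measurable.prodMk ?_ ?_)
    · refine Measurable.add (hX0.mono (hle _) le_rfl) ?_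
      refine Finset.measurable_sum _ fun t ht => ?_
      rw [Finset.mem_Icc] at ht
      exact ((hu t ht.1 (by omega)).mono (hle _) le_rfl).const_mul _
    · refine Measurable.sub measurable_const ?_
      refine Finset.measurable_sum _ fun t ht => ?_
      rw [Finset.mem_Icc] at ht
      exact (((hσ t ht.1 (by omega)).mono (hle _) le_rfl).pow_const 2).const_mul _
  have mk := mul_meas_ge_le_lintegral (μ := P) hmeas (ENNReal.ofReal (1 / 4))
  have h3 := mk.trans it
  have : P {ω | (X0 ω + ∑ t ∈ Finset.Icc 1 k, w t * (σ t ω * ε t ω)) ^ 2 ≤ h ∧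
        ∑ t ∈ Finset.Icc 1 k, w t ^ 2 * σ t ω ^ 2 ≤ vb ∧
        vb - h ≤ ∑ t ∈ Finset.Icc 1 k, w t ^ 2 * σ t ω ^ 2} ≤
      P {ω | ENNReal.ofReal (1 / 4) ≤ ENNReal.ofReal (heatF h (X0 ω + ∑ t ∈ Finset.Icc 1 k, w t * (σ t ω * ε t ω))
      (vb - ∑ t ∈ Finset.Icc 1 k, w t ^ 2 * σ t ω ^ 2))} := by
    refine measure_mono ?_
    rintro ω ⟨h1, h2, h3⟩
    refine ENNReal.ofReal_le_ofReal ?_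
    generalize (X0 ω + ∑ t ∈ Finset.Icc 1 k, w t * (σ t ω * ε t ω)) = Y at *
    generalize ∑ t ∈ Finset.Icc 1 k, w t ^ 2 * σ t ω ^ 2 = V at *
    have h0 : 0 ≤ vb - V := by linarith
    have hp : 0 < h + (vb - V) := by linarith
    simp only [heatF, h0, if_true]
    have e1 : (1 / 2 : ℝ) ≤ Real.sqrt (h / (h + (vb - V))) := by
      apply Real.le_sqrt_of_sq_le
      rw [le_div_iff₀ hp]; linarith
    have e2 : (1 / 2 : ℝ) ≤ Real.exp (-Y ^ 2 / (2 * (h + (vb - V)))) := by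
      have : -(1 / 2 : ℝ) ≤ -Y ^ 2 / (2 * (h + (vb - V))) := by
        rw [le_div_iff₀ (by positivity)]; linarith
      have := (Real.add_one_le_exp (-(1 / 2 : ℝ))).trans (Real.exp_le_exp.2 this)
      linarith
    calc (1 / 4 : ℝ) = 1 / 2 * (1 / 2) := by norm_num
      _ ≤ _ := mul_le_mul e1 e2 (by norm_num) (by positivity)
  refine this.trans ?_
  rw [ENNReal.ofReal_mul (by norm_num)]
  set M := P {ω | ENNReal.ofReal (1 / 4) ≤ ENNReal.ofReal (heatF h (X0 ω + ∑ t ∈ Finset.Icc 1 k, w t * (σ t ω * ε t ω))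
      (vb - ∑ t ∈ Finset.Icc 1 k, w t ^ 2 * σ t ω ^ 2))}
  calc M = ENNReal.ofReal 4 * (ENNReal.ofReal (1 / 4) * M) := by
        rw [← mul_assoc, ← ENNReal.ofReal_mul (by norm_num)]; norm_num
    _ ≤ _ := by gcongr


lemma sq_meas_bound {Ω : Type*} (m : MeasurableSpace Ω) [MeasurableSpace Ω] (P : Measure Ω)
    [IsProbabilityMeasure P] (hm : m ≤ ‹MeasurableSpace Ω›)
    (s e : Ω → ℝ) (hs : Measurable[m] s) (hsi : Integrable (fun ω => s ω ^ 2) P)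
    (he : Measurable e) (hg : Measure.map e P = gaussianReal 0 1)
    (hi : Indep (MeasurableSpace.comap e inferInstance) m P) :
    ∫⁻ ω, ENNReal.ofReal ((s ω * e ω) ^ 2) ∂P = ENNReal.ofReal (∫ ω, s ω ^ 2 ∂P) := by
  have hind : IndepFun s e P := by
    have := indep_of_indep_of_le_right hi hs.comap_le
    exact (IndepFun_iff_Indep _ _ _).2 this.symm
  have hs' : Measurable s := hs.mono hm le_rfl
  have hq : Measurable (fun x : ℝ => ENNReal.ofReal (x ^ 2)) := by fun_prop
  have hind2 : IndepFun (fun ω => ENNReal.ofReal (s ω ^ 2)) (fun ω => ENNReal.ofReal (e ω ^ 2)) P :=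
    hind.comp hq hq
  have h1 : ∀ ω, ENNReal.ofReal ((s ω * e ω) ^ 2) = ENNReal.ofReal (s ω ^ 2) * ENNReal.ofReal (e ω ^ 2) := by
    intro ω; rw [mul_pow, ENNReal.ofReal_mul (sq_nonneg _)]
  simp_rw [h1]
  have := lintegral_mul_eq_lintegral_mul_lintegral_of_indepFun (hq.comp hs') (hq.comp he) hind2
  have h2 : ∫⁻ ω, ENNReal.ofReal (e ω ^ 2) ∂P = 1 := by
    rw [← lintegral_map (f := fun x : ℝ => ENNReal.ofReal (x ^ 2)) (g := e) hq he, hg]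
    rw [← ofReal_integral_eq_lintegral_ofReal]
    · have hv := variance_id_gaussianReal (μ := 0) (v := 1)
      rw [variance_eq_integral (by fun_prop)] at hv
      simp at hv
      rw [hv]; simp
    · exact (memLp_id_gaussianReal 2).integrable_sq
    · exact Eventually.of_forall fun x => sq_nonneg x
  calc _ = (∫⁻ ω, ENNReal.ofReal (s ω ^ 2) ∂P) * ∫⁻ ω, ENNReal.ofReal (e ω ^ 2) ∂P := this
    _ = _ := by
      rw [h2, mul_one, ofReal_integral_eq_lintegral_ofReal hsi (Eventually.of_forall fun x => sq_nonneg _)]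

/-- Markov bound for the sum of squared innovations. -/
lemma markovU {Ω : Type*} [MeasurableSpace Ω] (P : Measure Ω) [IsProbabilityMeasure P]
    (F : ℕ → MeasurableSpace Ω) (hle : ∀ t, F t ≤ ‹MeasurableSpace Ω›)
    (σ ε : ℕ → Ω → ℝ) (n : ℕ) (hn : 1 ≤ n)
    (hσ : ∀ t, 1 ≤ t → t ≤ n → Measurable[F (t - 1)] (σ t))
    (hσi : ∀ t, 1 ≤ t → t ≤ n → Integrable (fun ω => (σ t ω) ^ 2) P)
    (hε : ∀ t, Measurable (ε t))
    (hg : ∀ t, 1 ≤ t → t ≤ n → Measure.map (ε t) P = gaussianReal 0 1)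
    (hi : ∀ t, 1 ≤ t → t ≤ n → Indep (MeasurableSpace.comap (ε t) inferInstance) (F (t - 1)) P)
    (T : ℝ) (hT : T = ∑ t ∈ Finset.Icc 1 n, ∫ ω, (σ t ω) ^ 2 ∂P) (hT0 : 0 < T) :
    P {ω | n * T ≤ ∑ t ∈ Finset.Icc 1 n, (σ t ω * ε t ω) ^ 2} ≤ ENNReal.ofReal (1 / n) := by
  have hn' : (0 : ℝ) < n := by exact_mod_cast hn
  have hm : ∀ t ∈ Finset.Icc 1 n, Measurable (fun ω => ENNReal.ofReal ((σ t ω * ε t ω) ^ 2)) := by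
    intro t ht
    rw [Finset.mem_Icc] at ht
    have := (hσ t ht.1 ht.2).mono (hle _) le_rfl
    have := hε t
    fun_prop
  have h1 : ∫⁻ ω, ∑ t ∈ Finset.Icc 1 n, ENNReal.ofReal ((σ t ω * ε t ω) ^ 2) ∂P = ENNReal.ofReal T := by
    rw [lintegral_finsetSum _ hm, hT, ENNReal.ofReal_sum_of_nonneg]
    · refine Finset.sum_congr rfl fun t ht => ?_
      rw [Finset.mem_Icc] at ht
      exact sq_meas_bound (F (t - 1)) P (hle _) _ _ (hσ t ht.1 ht.2) (hσi t ht.1 ht.2) (hε t)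
        (hg t ht.1 ht.2) (hi t ht.1 ht.2)
    · intro t _; exact integral_nonneg fun ω => sq_nonneg _
  have mk := mul_meas_ge_le_lintegral (μ := P) (Finset.measurable_sum _ hm) (ENNReal.ofReal (n * T))
  rw [h1] at mk
  have : {ω | n * T ≤ ∑ t ∈ Finset.Icc 1 n, (σ t ω * ε t ω) ^ 2} ⊆
      {ω | ENNReal.ofReal (n * T) ≤ ∑ t ∈ Finset.Icc 1 n, ENNReal.ofReal ((σ t ω * ε t ω) ^ 2)} := by
    intro ω hω
    simp only [Set.mem_ofPred_eq] at hω ⊢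
    rw [← ENNReal.ofReal_sum_of_nonneg (fun _ _ => sq_nonneg _)]
    exact ENNReal.ofReal_le_ofReal hω
  refine (measure_mono this).trans ?_
  set M := P {ω | ENNReal.ofReal (n * T) ≤ ∑ t ∈ Finset.Icc 1 n, ENNReal.ofReal ((σ t ω * ε t ω) ^ 2)}
  calc M = ENNReal.ofReal (1 / (n * T)) * (ENNReal.ofReal (n * T) * M) := by
        rw [← mul_assoc, ← ENNReal.ofReal_mul (by positivity), one_div_mul_cancel (by positivity)]; simp
    _ ≤ ENNReal.ofReal (1 / (n * T)) * ENNReal.ofReal T := by gcongr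
    _ = ENNReal.ofReal (1 / n) := by
        rw [← ENNReal.ofReal_mul (by positivity)]; congr 1; field_simp

/-- Closed form of the explosive path. -/
lemma path_form (x u : ℕ → ℝ) (d : ℝ) (hd : 0 ≤ d) (b τ : ℕ) 
    (hx : ∀ t, 1 ≤ t → t ≤ τ → x t = (if b ≤ t then 1 + d else 1) * x (t - 1) + u t) (k : ℕ) (hk : k ≤ τ)
    (hb : 1 ≤ b) :
    x k = (1 + d) ^ (k + 1 - b) * (x 0 + ∑ t ∈ Finset.Icc 1 k, ((1 + d) ^ (t + 1 - b))⁻¹ * u t) := by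
  have hd1 : (1 + d) ≠ 0 := by positivity
  induction k with
  | zero =>
    have : 0 + 1 - b = 0 := by omega
    simp [this]
  | succ k ih =>
    have ih := ih (by omega)
    rw [hx (k + 1) (by omega) hk, Finset.sum_Icc_succ_top (by omega), Nat.add_sub_cancel, ih]
    by_cases h : b ≤ k + 1
    · have e : k + 1 + 1 - b = (k + 1 - b) + 1 := by omega
      rw [if_pos h, e, pow_succ]
      have := pow_ne_zero (k + 1 - b) hd1
      field_simp
      ring
    · have e : k + 1 + 1 - b = 0 := by omega
      have e' : k + 1 - b = 0 := by omega
      rw [if_neg h, e, e']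
      simp; ring

lemma path_bound (x u : ℕ → ℝ) (d : ℝ) (b τ : ℕ) 
    (hx : ∀ t, 1 ≤ t → t ≤ τ → x t = (if b ≤ t then 1 + d else 1) * x (t - 1) + u t) (k : ℕ) (hk : k ≤ τ)
    (hkb : k < b) (U : ℝ) (hU : ∑ t ∈ Finset.Icc 1 τ, u t ^ 2 ≤ U) :
    x k ^ 2 ≤ 2 * x 0 ^ 2 + 2 * τ * U := by
  have h1 : ∀ j, j ≤ k → x j = x 0 + ∑ t ∈ Finset.Icc 1 j, u t := by
    intro j
    induction j with
    | zero => simp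
    | succ j ih =>
      intro hj
      rw [hx (j + 1) (by omega) (by omega), Finset.sum_Icc_succ_top (by omega), Nat.add_sub_cancel,
        ih (by omega), if_neg (by omega)]
      ring
  rw [h1 k le_rfl]
  have cs := sq_sum_le_card_mul_sum_sq (s := Finset.Icc 1 k) (f := u)
  have hsub : ∑ t ∈ Finset.Icc 1 k, u t ^ 2 ≤ ∑ t ∈ Finset.Icc 1 τ, u t ^ 2 :=
    Finset.sum_le_sum_of_subset_of_nonneg (Finset.Icc_subset_Icc_right hk) fun _ _ _ => sq_nonneg _
  simp only [Nat.card_Icc, Nat.add_sub_cancel] at cs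
  have h0 : 0 ≤ ∑ t ∈ Finset.Icc 1 k, u t ^ 2 := Finset.sum_nonneg fun _ _ => sq_nonneg _
  have hkτ : (k : ℝ) ≤ τ := by exact_mod_cast hk
  have : (k : ℝ) * ∑ t ∈ Finset.Icc 1 k, u t ^ 2 ≤ τ * U :=
    mul_le_mul hkτ (hsub.trans hU) h0 (by positivity)
  nlinarith [sq_nonneg (x 0 - ∑ t ∈ Finset.Icc 1 k, u t)]

lemma delta_bound {Ω : Type*} (X : ℕ → Ω → ℝ) (ω : Ω) (u : ℕ → ℝ) (d : ℝ) (b τ : ℕ) (hτ : 2 ≤ τ)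
    (hx : ∀ t, 1 ≤ t → t ≤ τ → X t ω = (if b ≤ t then 1 + d else 1) * X (t - 1) ω + u t)
    (U : ℝ) (hU : ∑ t ∈ Finset.Icc 1 τ, u t ^ 2 ≤ U)
    (hD : X (τ - 1) ω ≠ X 0 ω) :
    (deltaHat X τ ω - 1 - d) ^ 2 * ((X (τ - 1) ω - X 0 ω) ^ 2 / 2) ≤
      2 * U + 2 * d ^ 2 * (τ * (2 * X 0 ω ^ 2 + 2 * τ * U)) := by
  have hτ0 : (τ : ℝ) ≠ 0 := by positivity
  set e : ℕ → ℝ := fun t => u t - (if b ≤ t then 0 else d * X (t - 1) ω) with he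
  set D := ∑ j ∈ Finset.Icc 1 τ, (xtil X τ (j - 1) ω) ^ 2 with hDdef
  have hDlow : (X (τ - 1) ω - X 0 ω) ^ 2 / 2 ≤ D := by
    have hsub : ({1, τ} : Finset ℕ) ⊆ Finset.Icc 1 τ := by
      intro j hj
      simp only [Finset.mem_insert, Finset.mem_singleton] at hj
      rw [Finset.mem_Icc]; omega
    have := Finset.sum_le_sum_of_subset_of_nonneg (f := fun j => (xtil X τ (j - 1) ω) ^ 2) hsub
      fun _ _ _ => sq_nonneg _
    rw [Finset.sum_pair (by omega)] at this
    simp only [xtil, Nat.sub_self] at this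
    refine le_trans ?_ this
    nlinarith [sq_nonneg (X 0 ω - xbar X τ ω + (X (τ - 1) ω - xbar X τ ω))]
  have hpos : 0 < (X (τ - 1) ω - X 0 ω) ^ 2 / 2 := by
    have := sub_ne_zero.2 hD
    positivity
  have hDpos : 0 < D := hpos.trans_le hDlow
  have hxt : ∑ j ∈ Finset.Icc 1 τ, xtil X τ (j - 1) ω = 0 := by
    simp only [xtil, Finset.sum_sub_distrib, Finset.sum_const, Nat.card_Icc, Nat.add_sub_cancel,
      nsmul_eq_mul, xbar]
    field_simp
    ring
  have hself : ∑ j ∈ Finset.Icc 1 τ, xtil X τ (j - 1) ω * X (j - 1) ω = D := by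
    have : ∀ j, xtil X τ (j - 1) ω * X (j - 1) ω
        = xtil X τ (j - 1) ω ^ 2 + xbar X τ ω * xtil X τ (j - 1) ω := by
      intro j; simp only [xtil]; ring
    simp_rw [this]
    rw [Finset.sum_add_distrib, ← Finset.mul_sum, hxt, mul_zero, add_zero]
  have hnum : ∑ j ∈ Finset.Icc 1 τ, xtil X τ (j - 1) ω * X j ω
      = (1 + d) * D + ∑ j ∈ Finset.Icc 1 τ, xtil X τ (j - 1) ω * e j := by
    rw [← hself, Finset.mul_sum, ← Finset.sum_add_distrib]
    refine Finset.sum_congr rfl fun j hj => ?_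
    rw [Finset.mem_Icc] at hj
    rw [hx j hj.1 hj.2]
    simp only [he]
    split_ifs <;> ring
  have hdel : deltaHat X τ ω - 1 - d = (∑ j ∈ Finset.Icc 1 τ, xtil X τ (j - 1) ω * e j) / D := by
    unfold deltaHat
    rw [← hDdef, hnum]
    field_simp
    ring
  have cs := Finset.sum_mul_sq_le_sq_mul_sq (Finset.Icc 1 τ) (fun j => xtil X τ (j - 1) ω) e
  rw [← hDdef] at cs
  have hee : ∑ j ∈ Finset.Icc 1 τ, e j ^ 2 ≤ 2 * U + 2 * d ^ 2 * (τ * (2 * X 0 ω ^ 2 + 2 * τ * U)) := by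
    have hU0 : 0 ≤ U := le_trans (Finset.sum_nonneg fun _ _ => sq_nonneg _) hU
    have : ∀ j ∈ Finset.Icc 1 τ, e j ^ 2 ≤ 2 * u j ^ 2 + 2 * d ^ 2 * (2 * X 0 ω ^ 2 + 2 * τ * U) := by
      intro j hj
      rw [Finset.mem_Icc] at hj
      simp only [he]
      split_ifs with hb
      · have : 0 ≤ 2 * d ^ 2 * (2 * X 0 ω ^ 2 + 2 * τ * U) := by positivity
        nlinarith [sq_nonneg (u j)]
      · have pb := path_bound (fun t => X t ω) u d b τ hx (j - 1) (by omega) (by omega) U hU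
        have := mul_le_mul_of_nonneg_left pb (sq_nonneg d)
        nlinarith [sq_nonneg (u j + d * X (j - 1) ω)]
    refine (Finset.sum_le_sum this).trans ?_
    rw [Finset.sum_add_distrib, ← Finset.mul_sum, Finset.sum_const, Nat.card_Icc, Nat.add_sub_cancel,
      nsmul_eq_mul]
    nlinarith
  calc (deltaHat X τ ω - 1 - d) ^ 2 * ((X (τ - 1) ω - X 0 ω) ^ 2 / 2)
      ≤ (deltaHat X τ ω - 1 - d) ^ 2 * D := by gcongr
    _ = (∑ j ∈ Finset.Icc 1 τ, xtil X τ (j - 1) ω * e j) ^ 2 / D := by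
        rw [hdel]; field_simp
    _ ≤ ∑ j ∈ Finset.Icc 1 τ, e j ^ 2 := by
        rw [div_le_iff₀ hDpos]; linarith
    _ ≤ _ := hee

lemma floor_div_tendsto (ρ : ℝ) (hρ : 0 ≤ ρ) :
    Tendsto (fun n : ℕ => (⌊(n : ℝ) * ρ⌋₊ : ℝ) / n) atTop (nhds ρ) := by
  have := (tendsto_nat_floor_mul_div_atTop (R := ℝ) hρ).comp tendsto_natCast_atTop_atTop
  refine this.congr fun n => ?_
  simp [mul_comm]

lemma growth (c α ρ1 ρ2 : ℝ) (hc : 0 < c) (hα0 : 0 < α) (hα : α < 1) (h1 : 0 ≤ ρ1) (h12 : ρ1 < ρ2) :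
    ∀ᶠ n : ℕ in atTop, (n : ℝ) ^ 5 ≤
      (1 + c * (n : ℝ) ^ (-α)) ^ (⌊(n : ℝ) * ρ2⌋₊ - ⌊(n : ℝ) * ρ1⌋₊) := by
  set C := (ρ2 - ρ1) / 2 * (c / (1 + c)) with hC
  have hCpos : 0 < C := by
    have : 0 < ρ2 - ρ1 := by linarith
    positivity
  have hlog := ((isLittleO_log_rpow_atTop (r := 1 - α) (by linarith)).comp_tendsto
    (tendsto_natCast_atTop_atTop (R := ℝ))).def (c := C / 5) (by positivity)
  have hfl := ((floor_div_tendsto ρ2 (by linarith)).sub (floor_div_tendsto ρ1 h1)).eventually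
    (lt_mem_nhds (show (ρ2 - ρ1) / 2 < ρ2 - ρ1 by linarith))
  filter_upwards [hlog, hfl, eventually_ge_atTop 1] with n h1 h2 hn
  have hn0 : (0 : ℝ) < n := by exact_mod_cast hn
  have hn1 : (1 : ℝ) ≤ n := by exact_mod_cast hn
  set x := c * (n : ℝ) ^ (-α) with hx
  have hx0 : 0 < x := by positivity
  have hxc : x ≤ c := by
    have : (n : ℝ) ^ (-α) ≤ 1 := Real.rpow_le_one_of_one_le_of_nonpos hn1 (by linarith)
    nlinarith
  set K := ⌊(n : ℝ) * ρ2⌋₊ - ⌊(n : ℝ) * ρ1⌋₊ with hK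
  have hKr : (n : ℝ) * ((ρ2 - ρ1) / 2) ≤ K := by
    rw [← sub_div, lt_div_iff₀ hn0] at h2
    have hle : ⌊(n : ℝ) * ρ1⌋₊ ≤ ⌊(n : ℝ) * ρ2⌋₊ := Nat.floor_mono (by nlinarith)
    rw [hK, Nat.cast_sub hle]; linarith
  have hl : x / (1 + c) ≤ Real.log (1 + x) := by
    have := Real.one_sub_inv_le_log_of_pos (show 0 < 1 + x by linarith)
    refine le_trans ?_ this
    have e : 1 - (1 + x)⁻¹ = x / (1 + x) := by field_simp; ring
    rw [e]
    gcongr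
  have hexp : 5 * Real.log n ≤ K * Real.log (1 + x) := by
    simp only [Function.comp, Real.norm_eq_abs] at h1
    rw [abs_of_nonneg (Real.log_nonneg hn1), abs_of_nonneg (by positivity)] at h1
    have hpow : (n : ℝ) ^ (1 - α) = n * (n : ℝ) ^ (-α) := by
      rw [sub_eq_add_neg, Real.rpow_add hn0, Real.rpow_one]
    calc 5 * Real.log n ≤ C * (n : ℝ) ^ (1 - α) := by linarith
      _ = (n : ℝ) * ((ρ2 - ρ1) / 2) * (x / (1 + c)) := by rw [hpow, hC, hx]; field_simp
      _ ≤ K * Real.log (1 + x) := mul_le_mul hKr hl (by positivity) (by positivity)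
  have := Real.exp_le_exp.2 hexp
  have e5 : (5 : ℝ) * Real.log n = Real.log ((n : ℝ) ^ 5) := by rw [Real.log_pow]; norm_num
  rw [e5, ← Real.log_pow, Real.exp_log (by positivity)] at this
  rwa [Real.exp_log (by positivity)] at this

lemma tendsto0_of (f : ℕ → ENNReal) (h : ∀ η : ℝ, 0 < η → ∀ᶠ n in atTop, f n ≤ ENNReal.ofReal η) :
    Tendsto f atTop (nhds 0) := by
  rw [ENNReal.tendsto_nhds_zero]
  intro e he
  by_cases ht : e = ⊤
  · simp [ht]
  · have := h e.toReal (ENNReal.toReal_pos he.ne' ht)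
    simpa [ENNReal.ofReal_toReal ht] using this

/-- Pathwise bound on the good event. -/
lemma det_bound {Ω : Type*} (X : ℕ → Ω → ℝ) (ω : Ω) (u : ℕ → ℝ) (c α : ℝ) (hc : 0 < c)
    (hα0 : 0 < α) (hα1 : α < 1) (n b τ : ℕ) (hτ : 2 ≤ τ) (hτn : τ ≤ n)
    (hx : ∀ t, 1 ≤ t → t ≤ τ → X t ω =
      (if b ≤ t then 1 + c * (n : ℝ) ^ (-α) else 1) * X (t - 1) ω + u t)
    (T L Y : ℝ) (hT : 0 < T) (hU : ∑ t ∈ Finset.Icc 1 n, u t ^ 2 ≤ n * T)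
    (hX0 : X 0 ω ^ 2 ≤ T) (hL : (n : ℝ) ^ 5 ≤ L) (hY : T / n ^ 2 ≤ Y ^ 2)
    (hXY : X (τ - 1) ω = L * Y) :
    ((n : ℝ) ^ α * (deltaHat X τ ω - 1) - c) ^ 2 ≤ (16 + 64 * c ^ 2) / n ^ 3 := by
  have hn2 : (2 : ℝ) ≤ n := by exact_mod_cast hτ.trans hτn
  have hn0 : (0 : ℝ) < n := by linarith
  have hτr : (τ : ℝ) ≤ n := by exact_mod_cast hτn
  set d := c * (n : ℝ) ^ (-α) with hd
  have hd0 : 0 < d := by positivity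
  have hdc : d ≤ c := by
    have : (n : ℝ) ^ (-α) ≤ 1 := Real.rpow_le_one_of_one_le_of_nonpos (by linarith) (by linarith)
    nlinarith
  have hU' : ∑ t ∈ Finset.Icc 1 τ, u t ^ 2 ≤ n * T :=
    le_trans (Finset.sum_le_sum_of_subset_of_nonneg (Finset.Icc_subset_Icc_right hτn)
      fun _ _ _ => sq_nonneg _) hU
  have hn8 : (2 : ℝ) ^ 8 ≤ (n : ℝ) ^ 8 := by gcongr
  have hLY : (n : ℝ) ^ 8 * T ≤ (L * Y) ^ 2 := by
    have h1 : ((n : ℝ) ^ 5) ^ 2 ≤ L ^ 2 := by gcongr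
    calc (n : ℝ) ^ 8 * T = ((n : ℝ) ^ 5) ^ 2 * (T / n ^ 2) := by field_simp
      _ ≤ L ^ 2 * Y ^ 2 := mul_le_mul h1 hY (by positivity) (by positivity)
      _ = _ := by ring
  have hdiff : (n : ℝ) ^ 8 * T / 8 ≤ (X (τ - 1) ω - X 0 ω) ^ 2 / 2 := by
    rw [hXY]
    nlinarith [sq_nonneg (L * Y - 2 * X 0 ω)]
  have hne : X (τ - 1) ω ≠ X 0 ω := by
    intro h
    rw [h, sub_self] at hdiff
    have : 0 < (n : ℝ) ^ 8 * T / 8 := by positivity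
    norm_num at hdiff
    linarith
  have key := delta_bound X ω u d b τ hτ hx (n * T) hU' hne
  have hr : 2 * (n * T) + 2 * d ^ 2 * (τ * (2 * X 0 ω ^ 2 + 2 * τ * (n * T)))
      ≤ (2 + 8 * c ^ 2) * (n ^ 3 * T) := by
    have h1 : (τ : ℝ) * (2 * X 0 ω ^ 2 + 2 * τ * (n * T)) ≤ n * (2 * T + 2 * n * (n * T)) := by gcongr
    have h2 : d ^ 2 ≤ c ^ 2 := by gcongr
    have h3 : 2 * d ^ 2 * (τ * (2 * X 0 ω ^ 2 + 2 * τ * (n * T))) ≤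
        2 * c ^ 2 * (n * (2 * T + 2 * n * (n * T))) := by gcongr
    have h4 : (n : ℝ) ≤ n ^ 3 := by nlinarith [mul_pos hn0 hn0]
    have h5 : (n : ℝ) * T ≤ n ^ 3 * T := by gcongr
    have h6 := mul_le_mul_of_nonneg_left h5 (sq_nonneg c)
    nlinarith
  set q := deltaHat X τ ω - 1 - d with hq
  have h1 : q ^ 2 * ((n : ℝ) ^ 8 * T / 8) ≤ (2 + 8 * c ^ 2) * (n ^ 3 * T) :=
    le_trans (by gcongr) (key.trans hr)
  have h2 : q ^ 2 ≤ (16 + 64 * c ^ 2) / n ^ 5 := by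
    rw [le_div_iff₀ (by positivity)]
    have : (q ^ 2 * n ^ 5) * (n ^ 3 * T) ≤ (16 + 64 * c ^ 2) * (n ^ 3 * T) := by nlinarith
    exact le_of_mul_le_mul_right this (by positivity)
  have hz : (n : ℝ) ^ α * (deltaHat X τ ω - 1) - c = (n : ℝ) ^ α * q := by
    have : (n : ℝ) ^ α * (n : ℝ) ^ (-α) = 1 := by
      rw [← Real.rpow_add hn0]; simp
    rw [hq, hd]; linear_combination c * this
  have hna : ((n : ℝ) ^ α) ^ 2 ≤ n ^ 2 := by
    have : (n : ℝ) ^ α ≤ n := by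
      conv_rhs => rw [← Real.rpow_one (n : ℝ)]
      exact Real.rpow_le_rpow_of_exponent_le (by linarith) hα1.le
    gcongr
  rw [hz, mul_pow]
  calc _ ≤ (n : ℝ) ^ 2 * ((16 + 64 * c ^ 2) / n ^ 5) := mul_le_mul hna h2 (sq_nonneg _) (by positivity)
    _ = _ := by field_simp

lemma sumSq_conv {Ω : Type*} [MeasurableSpace Ω] (P : ℕ → Measure Ω) (σ : ℕ → ℕ → Ω → ℝ)
    (hA1 : ∀ r ∈ Set.Ioc (0 : ℝ) 1, ∀ εp : ℝ, 0 < εp →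
      Tendsto (fun n : ℕ => P n {ω |
          εp ≤ |(∑ t ∈ Finset.Icc 1 ⌊(n : ℝ) * r⌋₊, (σ n t ω) ^ 2) /
            ((⌊(n : ℝ) * r⌋₊ : ℝ) * avgVar P σ n ⌊(n : ℝ) * r⌋₊) - 1|})
        atTop (nhds 0))
    (hA2 : ∃ ζ ∈ Set.Ioo (0 : ℝ) 1, ∃ g : ℕ → ℝ,
      g =o[atTop] (fun n : ℕ => (n : ℝ) ^ (-(1 : ℝ) / 2)) ∧
      ∀ n t : ℕ, (n : ℝ) ^ ζ < (t : ℝ) → t ≤ n →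
        |avgVar P σ n t / avgVar P σ n n - 1| ≤ g n)
    (ρ : ℝ) (hρ : ρ ∈ Set.Ioc (0 : ℝ) 1) (e : ℝ) (he : 0 < e) :
    Tendsto (fun n : ℕ => P n {ω |
          e ≤ |(∑ t ∈ Finset.Icc 1 ⌊(n : ℝ) * ρ⌋₊, (σ n t ω) ^ 2) /
            ((n : ℝ) * avgVar P σ n n) - ρ|})
        atTop (nhds 0) := by
  obtain ⟨ζ, hζ, g, hg, hA⟩ := hA2
  have hg0 : Tendsto g atTop (nhds 0) := by
    refine hg.trans_tendsto ?_
    have := (tendsto_rpow_neg_atTop (show (0 : ℝ) < 1 / 2 by norm_num)).comp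
      (tendsto_natCast_atTop_atTop (R := ℝ))
    refine this.congr fun n => ?_
    simp only [Function.comp]
    norm_num
  have hfl := floor_div_tendsto ρ hρ.1.le
  have hev : ∀ᶠ n : ℕ in atTop, (n : ℝ) ^ ζ < (⌊(n : ℝ) * ρ⌋₊ : ℝ) := by
    have h1 := ((tendsto_rpow_neg_atTop (show (0 : ℝ) < 1 - ζ by linarith [hζ.2])).comp
      (tendsto_natCast_atTop_atTop (R := ℝ))).eventually (gt_mem_nhds (show (0 : ℝ) < ρ / 2 by linarith [hρ.1]))
    have h2 := hfl.eventually (lt_mem_nhds (show ρ / 2 < ρ by linarith [hρ.1]))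
    filter_upwards [h1, h2, eventually_ge_atTop 1] with n h1 h2 hn
    have hn0 : (0 : ℝ) < n := by exact_mod_cast hn
    simp only [Function.comp] at h1
    have h3 := h1.trans h2
    rw [lt_div_iff₀ hn0] at h3
    refine lt_of_eq_of_lt ?_ h3
    conv_rhs => rw [← Real.rpow_one (n : ℝ), ← Real.rpow_mul hn0.le, ← Real.rpow_add (by simpa using hn0)]
    simp
  set bb : ℕ → ℝ := fun n => (⌊(n : ℝ) * ρ⌋₊ : ℝ) / n *
    (avgVar P σ n ⌊(n : ℝ) * ρ⌋₊ / avgVar P σ n n) with hbb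
  have hb : Tendsto bb atTop (nhds ρ) := by
    have : Tendsto (fun n : ℕ => avgVar P σ n ⌊(n : ℝ) * ρ⌋₊ / avgVar P σ n n) atTop (nhds 1) := by
      have h0 : Tendsto (fun n : ℕ => avgVar P σ n ⌊(n : ℝ) * ρ⌋₊ / avgVar P σ n n - 1) atTop (nhds 0) := by
        refine squeeze_zero_norm' ?_ hg0
        filter_upwards [hev] with n hn
        refine hA n _ hn ?_
        have : (n : ℝ) * ρ ≤ n := mul_le_of_le_one_right (by positivity) hρ.2
        exact Nat.floor_le_of_le this
      simpa using h0.add_const 1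
    simpa using hfl.mul this
  have hb1 := hb.eventually (Metric.ball_mem_nhds ρ (show 0 < min (e / 2) (ρ / 2) by
    have := hρ.1; positivity))
  refine tendsto_of_tendsto_of_tendsto_of_le_of_le' tendsto_const_nhds
    (hA1 ρ hρ (e / 4) (by positivity)) (Eventually.of_forall fun _ => zero_le) ?_
  filter_upwards [hb1] with n hn
  refine measure_mono fun ω hω => ?_
  simp only [Set.mem_ofPred_eq] at hω ⊢
  rw [Real.dist_eq, lt_min_iff] at hn
  have hbpos : bb n ≠ 0 := by
    intro h
    rw [h, zero_sub, abs_neg, abs_of_pos hρ.1] at hn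
    linarith [hn.2, hρ.1]
  generalize hS : ∑ t ∈ Finset.Icc 1 ⌊(n : ℝ) * ρ⌋₊, (σ n t ω) ^ 2 = S at *
  set A := S / ((⌊(n : ℝ) * ρ⌋₊ : ℝ) * avgVar P σ n ⌊(n : ℝ) * ρ⌋₊) with hAdef
  have hprod : S / ((n : ℝ) * avgVar P σ n n) = A * bb n := by
    simp only [hbb] at hbpos
    have h1 : (⌊(n : ℝ) * ρ⌋₊ : ℝ) ≠ 0 := fun h => hbpos (by simp [h])
    have h2 : avgVar P σ n ⌊(n : ℝ) * ρ⌋₊ ≠ 0 := fun h => hbpos (by simp [h])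
    rw [hAdef, hbb]
    field_simp
  rw [hprod] at hω
  by_contra hlt
  push Not at hlt
  have hb2 : |bb n| ≤ 2 := by
    have h3 := hn.2
    rw [abs_lt] at h3
    rw [abs_le]
    constructor <;> linarith [hρ.1, hρ.2]
  have : |A * bb n - ρ| ≤ |A - 1| * |bb n| + |bb n - ρ| := by
    rw [← abs_mul]
    have e1 : A * bb n - ρ = (A - 1) * bb n + (bb n - ρ) := by ring
    rw [e1]; exact abs_add_le _ _
  nlinarith [abs_nonneg (A - 1), abs_nonneg (bb n)]

lemma V_conv {Ω : Type*} [MeasurableSpace Ω] (P : ℕ → Measure Ω) (σ : ℕ → ℕ → Ω → ℝ) (T : ℕ → ℝ)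
    (hT : ∀ n, 1 ≤ n → 0 < T n)
    (hR : ∀ ρ ∈ Set.Ioc (0 : ℝ) 1, ∀ e : ℝ, 0 < e → Tendsto (fun n : ℕ => P n {ω |
          e ≤ |(∑ t ∈ Finset.Icc 1 ⌊(n : ℝ) * ρ⌋₊, (σ n t ω) ^ 2) / T n - ρ|}) atTop (nhds 0))
    (c α re r : ℝ) (hc : 0 < c) (hα0 : 0 < α) (hα1 : α < 1) (hre : 0 < re) (hrer : re < r) (hr1 : r < 1)
    (e : ℝ) (he : 0 < e) :
    Tendsto (fun n : ℕ => P n {ω | e ≤ |(∑ t ∈ Finset.Icc 1 (⌊(n : ℝ) * r⌋₊ - 1),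
      (((1 + c * (n : ℝ) ^ (-α)) ^ (t + 1 - ⌊(n : ℝ) * re⌋₊))⁻¹) ^ 2 * (σ n t ω) ^ 2) / T n - re|})
      atTop (nhds 0) := by
  obtain ⟨κ, hκ0, hκe, hκre, hκr⟩ : ∃ κ : ℝ, 0 < κ ∧ κ ≤ e / 8 ∧ κ ≤ re / 2 ∧ κ ≤ (r - re) / 2 :=
    ⟨min (e / 8) (min (re / 2) ((r - re) / 2)), by
      have : 0 < r - re := by linarith
      positivity, min_le_left _ _, (min_le_right _ _).trans (min_le_left _ _),
      (min_le_right _ _).trans (min_le_right _ _)⟩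
  have e1 := hR (re - κ) ⟨by linarith, by linarith⟩ κ hκ0
  have e2 := hR (re + κ) ⟨by linarith, by linarith⟩ κ hκ0
  have e3 := hR 1 ⟨by norm_num, le_rfl⟩ 1 one_pos
  have hsum := (e1.add e2).add e3
  simp only [add_zero] at hsum
  refine tendsto_of_tendsto_of_tendsto_of_le_of_le' tendsto_const_nhds hsum
    (Eventually.of_forall fun _ => zero_le) ?_
  have f1 := ((floor_div_tendsto re hre.le).sub (floor_div_tendsto (re - κ) (by linarith))).eventually
    (lt_mem_nhds (show 0 < re - (re - κ) by linarith))
  have f2 := ((floor_div_tendsto r (by linarith)).sub (floor_div_tendsto re hre.le)).eventually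
    (lt_mem_nhds (show 0 < r - re by linarith))
  have f3 := growth c α re (re + κ) hc hα0 hα1 hre.le (by linarith)
  have f4 := (tendsto_natCast_atTop_atTop (R := ℝ)).eventually (eventually_ge_atTop (1 / κ))
  filter_upwards [f1, f2, f3, f4, eventually_ge_atTop 1] with n f1 f2 f3 f4 hn
  have hn0 : (0 : ℝ) < n := by exact_mod_cast hn
  have hn1 : (1 : ℝ) ≤ n := by exact_mod_cast hn
  have hTn := hT n hn
  refine le_trans (measure_mono ?_) (measure_union_le _ _) |>.trans
    (add_le_add (measure_union_le _ _) le_rfl)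
  intro ω hω
  by_contra hcon
  simp only [Set.mem_union, Set.mem_ofPred_eq, not_or, not_le] at hcon hω
  obtain ⟨⟨g1, g2⟩, g3⟩ := hcon
  have hb1 : ⌊(n : ℝ) * (re - κ)⌋₊ < ⌊(n : ℝ) * re⌋₊ := by
    rw [← sub_div] at f1
    have := (div_pos_iff_of_pos_right hn0).1 f1
    exact_mod_cast sub_pos.1 this
  have hbτ : ⌊(n : ℝ) * re⌋₊ < ⌊(n : ℝ) * r⌋₊ := by
    rw [← sub_div] at f2
    have := (div_pos_iff_of_pos_right hn0).1 f2
    exact_mod_cast sub_pos.1 this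
  have hfn : ∀ ρ : ℝ, ρ ≤ 1 → ⌊(n : ℝ) * ρ⌋₊ ≤ n := fun ρ h =>
    Nat.floor_le_of_le (mul_le_of_le_one_right hn0.le h)
  have hτn := hfn r hr1.le
  have hb2n := hfn (re + κ) (by linarith)
  have hn1' : ⌊(n : ℝ) * 1⌋₊ = n := by simp
  rw [hn1'] at g3
  set b1 := ⌊(n : ℝ) * (re - κ)⌋₊
  set b := ⌊(n : ℝ) * re⌋₊
  set b2 := ⌊(n : ℝ) * (re + κ)⌋₊
  set τ := ⌊(n : ℝ) * r⌋₊
  set δ := 1 + c * (n : ℝ) ^ (-α) with hδ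
  have hδ1 : 1 ≤ δ := by
    have : 0 < c * (n : ℝ) ^ (-α) := by positivity
    linarith
  set V := ∑ t ∈ Finset.Icc 1 (τ - 1), ((δ ^ (t + 1 - b))⁻¹) ^ 2 * (σ n t ω) ^ 2 with hV
  have low : ∑ t ∈ Finset.Icc 1 b1, (σ n t ω) ^ 2 ≤ V := by
    refine le_trans (le_of_eq ?_) (Finset.sum_le_sum_of_subset_of_nonneg
      (Finset.Icc_subset_Icc_right (show b1 ≤ τ - 1 by omega)) fun _ _ _ => by positivity)
    refine Finset.sum_congr rfl fun t ht => ?_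
    rw [Finset.mem_Icc] at ht
    have : t + 1 - b = 0 := by omega
    simp [this]
  have hw : ∀ t, ((δ ^ (t + 1 - b))⁻¹) ^ 2 ≤ (if t ≤ b2 then 1 else 0) + κ := by
    intro t
    have hp : 1 ≤ δ ^ (t + 1 - b) := one_le_pow₀ hδ1
    have hi1 : (δ ^ (t + 1 - b))⁻¹ ≤ 1 := inv_le_one_of_one_le₀ hp
    have hi0 : 0 ≤ (δ ^ (t + 1 - b))⁻¹ := by positivity
    split_ifs with h
    · nlinarith
    · have h5 : (n : ℝ) ≤ δ ^ (t + 1 - b) := by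
        calc (n : ℝ) ≤ n ^ 5 := le_self_pow₀ hn1 (by norm_num)
          _ ≤ δ ^ (b2 - b) := f3
          _ ≤ δ ^ (t + 1 - b) := pow_le_pow_right₀ hδ1 (by omega)
      have h6 : (δ ^ (t + 1 - b))⁻¹ ≤ κ := by
        rw [inv_le_comm₀ (by positivity) hκ0]
        rw [one_div] at f4
        linarith
      nlinarith
  have upp : V ≤ ∑ t ∈ Finset.Icc 1 b2, (σ n t ω) ^ 2 + κ * ∑ t ∈ Finset.Icc 1 n, (σ n t ω) ^ 2 := by
    calc V ≤ ∑ t ∈ Finset.Icc 1 n, ((δ ^ (t + 1 - b))⁻¹) ^ 2 * (σ n t ω) ^ 2 :=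
          Finset.sum_le_sum_of_subset_of_nonneg
            (Finset.Icc_subset_Icc_right (by omega)) fun _ _ _ => by positivity
      _ ≤ ∑ t ∈ Finset.Icc 1 n, ((if t ≤ b2 then (σ n t ω) ^ 2 else 0) + κ * (σ n t ω) ^ 2) := by
          refine Finset.sum_le_sum fun t _ => ?_
          have := mul_le_mul_of_nonneg_right (hw t) (sq_nonneg (σ n t ω))
          split_ifs at this ⊢ <;> linarith
      _ = _ := by
          rw [Finset.sum_add_distrib, ← Finset.mul_sum, ← Finset.sum_filter]
          congr 2
          ext t
          simp only [Finset.mem_filter, Finset.mem_Icc]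
          omega
  rw [abs_lt] at g1 g2 g3
  have low' := div_le_div_of_nonneg_right low hTn.le
  have upp' := div_le_div_of_nonneg_right upp hTn.le
  rw [add_div, mul_div_assoc] at upp'
  have : |V / T n - re| < e := by
    rw [abs_lt]
    constructor
    · linarith
    · nlinarith
  linarith

lemma div_sqrt_lt (x T : ℝ) (hT : 0 < T) (h : |x / Real.sqrt T| < 1) : x ^ 2 ≤ T := by
  rw [abs_div, abs_of_nonneg (Real.sqrt_nonneg T), div_lt_one (Real.sqrt_pos.2 hT)] at h
  have := pow_le_pow_left₀ (abs_nonneg x) h.le 2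
  rwa [sq_abs, Real.sq_sqrt hT.le] at this

/-- Divergence rate of the coefficient statistic during the bubble (displayed rate in
the proof of Theorem 3): in the bubble model, under Assumptions A1, A2 and the
initial-value condition, for every fixed `r` with `r_e < r ≤ r_f`,
`n^{α-1} SV-ADF^δ_{⌊nr⌋} → r c` in probability; in particular `SV-ADF^δ_{⌊nr⌋}`
diverges to `+∞` at rate `n^{1-α}`. -/
theorem stmt16
    {Ω : Type*} [MeasurableSpace Ω]
    (P : ℕ → Measure Ω) (hP : ∀ n, IsProbabilityMeasure (P n))
    (ℱ : ℕ → ℕ → MeasurableSpace Ω) (hℱmono : ∀ n, Monotone (ℱ n))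
    (hℱle : ∀ n t, ℱ n t ≤ ‹MeasurableSpace Ω›)
    (X σ ε : ℕ → ℕ → Ω → ℝ)
    (hX0meas : ∀ n, Measurable[ℱ n 0] (X n 0))
    (hσpos : ∀ n t, 1 ≤ t → t ≤ n → ∀ ω, 0 < σ n t ω)
    (hσmeas : ∀ n t, 1 ≤ t → t ≤ n → Measurable[ℱ n (t - 1)] (σ n t))
    (hσint : ∀ n t, 1 ≤ t → t ≤ n → Integrable (fun ω => (σ n t ω) ^ 2) (P n))
    (hεmeas : ∀ n t, Measurable (ε n t))
    (hεgauss : ∀ n t, 1 ≤ t → t ≤ n → Measure.map (ε n t) (P n) = gaussianReal 0 1)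
    (hεindep : ∀ n t, 1 ≤ t → t ≤ n →
      Indep (MeasurableSpace.comap (ε n t) inferInstance) (ℱ n (t - 1)) (P n))
    (huadapted : ∀ n t, 1 ≤ t → t ≤ n →
      Measurable[ℱ n t] (fun ω => σ n t ω * ε n t ω))
    -- bubble model parameters
    (r0 re rf c α : ℝ)
    (hr0 : 0 < r0) (hr0e : r0 < re) (href : re < rf) (hrf1 : rf < 1)
    (hc : 0 < c) (hα : α ∈ Set.Ioo (0 : ℝ) 1)
    -- model equations
    (hmodel : ∀ n t, 1 ≤ t → t ≤ n → ∀ ω,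
      X n t ω = (if ⌊(n : ℝ) * re⌋₊ ≤ t ∧ t ≤ ⌊(n : ℝ) * rf⌋₊
          then 1 + c * (n : ℝ) ^ (-α) else 1) * X n (t - 1) ω + σ n t ω * ε n t ω)
    -- Assumption A1
    (hA1 : ∀ r ∈ Set.Ioc (0 : ℝ) 1, ∀ εp : ℝ, 0 < εp →
      Tendsto (fun n : ℕ => P n {ω |
          εp ≤ |(∑ t ∈ Finset.Icc 1 ⌊(n : ℝ) * r⌋₊, (σ n t ω) ^ 2) /
            ((⌊(n : ℝ) * r⌋₊ : ℝ) * avgVar P σ n ⌊(n : ℝ) * r⌋₊) - 1|})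
        atTop (nhds 0))
    -- Assumption A2
    (hA2 : ∃ ζ ∈ Set.Ioo (0 : ℝ) 1, ∃ g : ℕ → ℝ,
      g =o[atTop] (fun n : ℕ => (n : ℝ) ^ (-(1 : ℝ) / 2)) ∧
      ∀ n t : ℕ, (n : ℝ) ^ ζ < (t : ℝ) → t ≤ n →
        |avgVar P σ n t / avgVar P σ n n - 1| ≤ g n)
    -- initial-value condition
    (hinit : ∀ εp : ℝ, 0 < εp →
      Tendsto (fun n : ℕ => P n {ω |
          εp ≤ |X n 0 ω / Real.sqrt ((n : ℝ) * avgVar P σ n n)|})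
        atTop (nhds 0))
    -- fixed fraction inside the bubble
    (r : ℝ) (hrer : re < r) (hrrf : r ≤ rf) :
    ∀ εp : ℝ, 0 < εp →
      Tendsto (fun n : ℕ => P n {ω |
          εp ≤ |(n : ℝ) ^ (α - 1) * svadfDelta (X n) ⌊(n : ℝ) * r⌋₊ ω - r * c|})
        atTop (nhds 0) := by
  have hre0 : 0 < re := hr0.trans hr0e
  have hr1 : r < 1 := lt_of_le_of_lt hrrf hrf1
  have hr00 : 0 < r := hre0.trans hrer
  obtain ⟨hα0, hα1⟩ := hα
  set T : ℕ → ℝ := fun n => (n : ℝ) * avgVar P σ n n with hTdef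
  have hTsum : ∀ n, 1 ≤ n → T n = ∑ t ∈ Finset.Icc 1 n, ∫ ω, (σ n t ω) ^ 2 ∂(P n) := by
    intro n hn
    have : (n : ℝ) ≠ 0 := by positivity
    simp only [hTdef, avgVar]
    field_simp
  have hTpos : ∀ n, 1 ≤ n → 0 < T n := by
    intro n hn
    rw [hTsum n hn]
    refine Finset.sum_pos (fun t ht => ?_) ⟨1, by simp [hn]⟩
    rw [Finset.mem_Icc] at ht
    rw [integral_pos_iff_support_of_nonneg (fun _ => sq_nonneg _) (hσint n t ht.1 ht.2)]
    have : Function.support (fun ω => (σ n t ω) ^ 2) = Set.univ := by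
      ext ω
      simp [(hσpos n t ht.1 ht.2 ω).ne']
    rw [this]
    have := hP n
    simp
  have hR := sumSq_conv P σ hA1 hA2
  have hV := V_conv P σ T hTpos hR c α re r hc hα0 hα1 hre0 hrer hr1
  set τ : ℕ → ℕ := fun n => ⌊(n : ℝ) * r⌋₊ with hτ
  set b : ℕ → ℕ := fun n => ⌊(n : ℝ) * re⌋₊ with hb
  set w : ℕ → ℕ → ℝ := fun n t => ((1 + c * (n : ℝ) ^ (-α)) ^ (t + 1 - b n))⁻¹ with hw
  set Y : ℕ → Ω → ℝ := fun n ω => X n 0 ω + ∑ t ∈ Finset.Icc 1 (τ n - 1), w n t * (σ n t ω * ε n t ω)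
    with hY
  have hτn : ∀ n, τ n ≤ n := fun n =>
    Nat.floor_le_of_le (mul_le_of_le_one_right (Nat.cast_nonneg n) hr1.le)
  -- anti-concentration
  have hanti : Tendsto (fun n => P n {ω | Y n ω ^ 2 ≤ T n / n ^ 2}) atTop (nhds 0) := by
    refine tendsto0_of _ fun η hη => ?_
    set h := re * η ^ 2 / 64 with hh
    have hh0 : 0 < h := by positivity
    have hV' := ENNReal.tendsto_nhds_zero.1 (hV (h / 2) (by positivity)) (ENNReal.ofReal (η / 2))
      (by simpa using hη)
    have hinv : ∀ᶠ n : ℕ in atTop, 1 / (n : ℝ) ^ 2 ≤ h := by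
      have : Tendsto (fun n : ℕ => 1 / (n : ℝ) ^ 2) atTop (nhds 0) := by
        have := (tendsto_pow_atTop (α := ℝ) (two_ne_zero)).comp (tendsto_natCast_atTop_atTop (R := ℝ))
        exact this.const_div_atTop 1
      exact (this.eventually (gt_mem_nhds hh0)).mono fun _ h => h.le
    filter_upwards [hV', hinv, eventually_ge_atTop 1] with n hV' hinv hn
    have hTn := hTpos n hn
    have := hP n
    have ac := anticonc (P n) (ℱ n) (hℱmono n) (hℱle n) (X n 0) (σ n) (ε n) n (hX0meas n) (hσmeas n)
      (hεmeas n) (hεgauss n) (hεindep n) (huadapted n) (w n) (h * T n) ((re + h / 2) * T n)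
      (by positivity) (by positivity) (τ n - 1) (by have := hτn n; omega)
    have hsub : {ω | Y n ω ^ 2 ≤ T n / n ^ 2} ⊆ {ω | h / 2 ≤ |(∑ t ∈ Finset.Icc 1 (τ n - 1),
        w n t ^ 2 * (σ n t ω) ^ 2) / T n - re|} ∪
        {ω | (X n 0 ω + ∑ t ∈ Finset.Icc 1 (τ n - 1), w n t * (σ n t ω * ε n t ω)) ^ 2 ≤ h * T n ∧
        ∑ t ∈ Finset.Icc 1 (τ n - 1), w n t ^ 2 * σ n t ω ^ 2 ≤ (re + h / 2) * T n ∧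
        (re + h / 2) * T n - h * T n ≤ ∑ t ∈ Finset.Icc 1 (τ n - 1), w n t ^ 2 * σ n t ω ^ 2} := by
      intro ω hω
      by_cases hc1 : h / 2 ≤ |(∑ t ∈ Finset.Icc 1 (τ n - 1), w n t ^ 2 * (σ n t ω) ^ 2) / T n - re|
      · exact Or.inl hc1
      · refine Or.inr ⟨?_, ?_⟩
        · refine le_trans hω ?_
          calc T n / (n : ℝ) ^ 2 = 1 / (n : ℝ) ^ 2 * T n := by ring
            _ ≤ _ := by gcongr
        · rw [not_le, abs_lt] at hc1
          have q1 : (∑ t ∈ Finset.Icc 1 (τ n - 1), w n t ^ 2 * (σ n t ω) ^ 2) / T n < re + h / 2 := by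
            linarith [hc1.2]
          have q2 : re - h / 2 < (∑ t ∈ Finset.Icc 1 (τ n - 1), w n t ^ 2 * (σ n t ω) ^ 2) / T n := by
            linarith [hc1.1]
          rw [div_lt_iff₀ hTn] at q1
          rw [lt_div_iff₀ hTn] at q2
          exact ⟨q1.le, by linarith⟩
    have hs : 4 * Real.sqrt (h * T n / (h * T n + (re + h / 2) * T n)) ≤ η / 2 := by
      have : Real.sqrt (h * T n / (h * T n + (re + h / 2) * T n)) ≤ η / 8 := by
        rw [Real.sqrt_le_left (by positivity)]
        rw [div_le_iff₀ (by positivity)]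
        have : h * T n = (η / 8) ^ 2 * (re * T n) := by rw [hh]; ring
        rw [this]
        gcongr
        have : 0 ≤ (η / 8) ^ 2 * (re * T n) := by positivity
        have : 0 ≤ h / 2 * T n := by positivity
        nlinarith
      linarith
    calc _ ≤ _ := measure_mono hsub
      _ ≤ _ := measure_union_le _ _
      _ ≤ ENNReal.ofReal (η / 2) + ENNReal.ofReal (η / 2) :=
          add_le_add hV' (ac.trans (ENNReal.ofReal_le_ofReal hs))
      _ = ENNReal.ofReal η := by
          rw [← ENNReal.ofReal_add (by positivity) (by positivity)]; congr 1; ring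
  have hUconv : Tendsto (fun n : ℕ => P n {ω | n * T n ≤ ∑ t ∈ Finset.Icc 1 n, (σ n t ω * ε n t ω) ^ 2})
      atTop (nhds 0) := by
    have h0 : Tendsto (fun n : ℕ => ENNReal.ofReal (1 / (n : ℝ))) atTop (nhds 0) := by
      have := ENNReal.tendsto_ofReal (tendsto_one_div_atTop_nhds_zero_nat (𝕜 := ℝ))
      simpa using this
    refine tendsto_of_tendsto_of_tendsto_of_le_of_le' tendsto_const_nhds h0
      (Eventually.of_forall fun _ => zero_le) ?_
    filter_upwards [eventually_ge_atTop 1] with n hn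
    have := hP n
    exact markovU (P n) (ℱ n) (hℱle n) (σ n) (ε n) n hn (hσmeas n) (hσint n) (hεmeas n) (hεgauss n)
      (hεindep n) (T n) (hTsum n hn) (hTpos n hn)
  intro εp hεp
  have hsum := (hanti.add hUconv).add (hinit 1 one_pos)
  simp only [add_zero] at hsum
  refine tendsto_of_tendsto_of_tendsto_of_le_of_le' tendsto_const_nhds hsum
    (Eventually.of_forall fun _ => zero_le) ?_
  have f1 := growth c α re r hc hα0 hα1 hre0.le hrer
  have f2 := (floor_div_tendsto r hr00.le).eventually
    (Metric.ball_mem_nhds r (show 0 < εp / (2 * c) by positivity))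
  have f3 : ∀ᶠ n : ℕ in atTop, (16 + 64 * c ^ 2) / (n : ℝ) ^ 3 < (εp / 2) ^ 2 := by
    have h3 := (tendsto_pow_atTop (α := ℝ) (three_ne_zero)).comp (tendsto_natCast_atTop_atTop (R := ℝ))
    have : Tendsto (fun n : ℕ => (16 + 64 * c ^ 2) / (n : ℝ) ^ 3) atTop (nhds 0) :=
      h3.const_div_atTop _
    exact this.eventually (gt_mem_nhds (by positivity))
  have f4 : ∀ᶠ n : ℕ in atTop, 2 ≤ τ n :=
    (tendsto_nat_floor_atTop.comp ((tendsto_natCast_atTop_atTop (R := ℝ)).atTop_mul_const hr00)).eventually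
      (eventually_ge_atTop 2)
  have f5 : ∀ᶠ n : ℕ in atTop, 1 ≤ b n :=
    (tendsto_nat_floor_atTop.comp ((tendsto_natCast_atTop_atTop (R := ℝ)).atTop_mul_const hre0)).eventually
      (eventually_ge_atTop 1)
  filter_upwards [f1, f2, f3, f4, f5, eventually_ge_atTop 1] with n f1 f2 f3 f4 f5 hn
  have hn0 : (0 : ℝ) < n := by exact_mod_cast hn
  have hTn := hTpos n hn
  refine le_trans (measure_mono ?_) (measure_union_le _ _) |>.trans
    (add_le_add (measure_union_le _ _) le_rfl)
  intro ω hω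
  by_contra hcon
  simp only [Set.mem_union, Set.mem_ofPred_eq, not_or, not_le] at hcon hω
  obtain ⟨⟨g1, g2⟩, g3⟩ := hcon
  have hτrf : τ n ≤ ⌊(n : ℝ) * rf⌋₊ := Nat.floor_mono (by gcongr)
  have hx : ∀ t, 1 ≤ t → t ≤ τ n → X n t ω =
      (if b n ≤ t then 1 + c * (n : ℝ) ^ (-α) else 1) * X n (t - 1) ω + σ n t ω * ε n t ω := by
    intro t h1 h2
    rw [hmodel n t h1 (h2.trans (hτn n)) ω]
    have : t ≤ ⌊(n : ℝ) * rf⌋₊ := h2.trans hτrf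
    simp only [this, and_true, hb]
  have hpf := path_form (fun t => X n t ω) (fun t => σ n t ω * ε n t ω) (c * (n : ℝ) ^ (-α))
    (by positivity) (b n) (τ n) hx (τ n - 1) (by omega) f5
  have hidx : τ n - 1 + 1 - b n = τ n - b n := by omega
  rw [hidx] at hpf
  have hdet := det_bound (X n) ω (fun t => σ n t ω * ε n t ω) c α hc hα0 hα1 n (b n) (τ n) f4 (hτn n) hx
    (T n) _ (Y n ω) hTn g2.le (div_sqrt_lt _ _ hTn g3) f1 g1.le hpf
  have hz := abs_lt_of_sq_lt_sq (hdet.trans_lt f3) (by positivity)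
  set q := deltaHat (X n) (τ n) ω - 1 with hq
  rw [Real.dist_eq, lt_div_iff₀ (by positivity)] at f2
  have hτr : (τ n : ℝ) / n ≤ 1 := by
    rw [div_le_one hn0]; exact_mod_cast hτn n
  have hτ0 : 0 ≤ (τ n : ℝ) / n := by positivity
  have hpow : (n : ℝ) ^ (α - 1) = (n : ℝ) ^ α / n := by rw [Real.rpow_sub hn0, Real.rpow_one]
  have hident : (n : ℝ) ^ (α - 1) * svadfDelta (X n) (τ n) ω - r * c =
      (τ n : ℝ) / n * ((n : ℝ) ^ α * q - c) + c * ((τ n : ℝ) / n - r) := by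
    unfold svadfDelta
    rw [hpow, ← hq]
    field_simp
    ring
  rw [hident] at hω
  have t1 := abs_add_le ((τ n : ℝ) / n * ((n : ℝ) ^ α * q - c)) (c * ((τ n : ℝ) / n - r))
  rw [abs_mul, abs_mul, abs_of_nonneg hτ0, abs_of_pos hc] at t1
  have t2 : (τ n : ℝ) / n * |(n : ℝ) ^ α * q - c| ≤ |(n : ℝ) ^ α * q - c| :=
    mul_le_of_le_one_left (abs_nonneg _) hτr
  have t3 : c * |(τ n : ℝ) / n - r| < εp / 2 := by
    have : |(τ n : ℝ) / n - r| * (2 * c) < εp := f2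
    linarith
  linarith
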